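/- arXiv:2111.07497 — 5 statements merged into one kernel-verified Lean document; each statement's English description precedes it below -/
import Mathlib

section
/- Let N₂ be a positive integer, let k > 0 and N_A > 0 be real constants, let a : Fin N₂ → ℕ, and let β : Fin N₂ → ℝ with β j > 0 for all j. Define the rate function r : ℝ → ℝ by r(V) = k · (V·N_A)^(1 − Σ_{j} a j) · ∏_{j} ∏_{m=0}^{a j − 1} (β j · V · N_A − m). Then the function V ↦ r(V)/V tends to k · N_A · ∏_{j} (β j)^(a j) as V → ∞. -/
open Filter Finset

/-- Internal-reaction case of Lemma 3.2 (Kurtz-type rate asymptotics):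
the mesoscopic rate `r(V) = k (V N_A)^{1-∑ a j} ∏_j (β_j V N_A)(β_j V N_A - 1)⋯(β_j V N_A - a_j + 1)`
satisfies `r(V)/V → k N_A ∏_j β_j^{a_j}` as `V → ∞`. -/
theorem limit_rate_internal (N₂ : ℕ) (hN₂ : 0 < N₂) (k NA : ℝ) (hk : 0 < k) (hNA : 0 < NA)
    (a : Fin N₂ → ℕ) (β : Fin N₂ → ℝ) (hβ : ∀ j, 0 < β j) (r : ℝ → ℝ)
    (hr : ∀ V : ℝ, r V =
      k * (V * NA) ^ ((1 : ℤ) - ∑ j, (a j : ℤ)) *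
        ∏ j, ∏ m ∈ Finset.range (a j), (β j * V * NA - (m : ℝ))) :
    Tendsto (fun V : ℝ => r V / V) atTop
      (nhds (k * NA * ∏ j, (β j) ^ (a j))) := by
  have hlim : Tendsto (fun V : ℝ => k * NA * ∏ j, ∏ m ∈ Finset.range (a j),
      (β j - (m : ℝ) / (V * NA))) atTop (nhds (k * NA * ∏ j, (β j) ^ (a j))) := by
    apply Tendsto.const_mul
    apply tendsto_finsetProd
    intro j _
    have h2 : (β j) ^ (a j) = ∏ m ∈ Finset.range (a j), (β j - 0) := by simp
    rw [h2]
    apply tendsto_finsetProd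
    intro m _
    apply Tendsto.const_sub
    exact (tendsto_id.atTop_mul_const hNA).const_div_atTop (m : ℝ)
  refine hlim.congr' ?_
  filter_upwards [eventually_gt_atTop 0] with V hV
  have hx : V * NA ≠ 0 := (mul_pos hV hNA).ne'
  have h1 : ∏ j, ∏ m ∈ Finset.range (a j), (β j * V * NA - (m : ℝ)) =
      (V * NA) ^ (∑ j, (a j : ℤ)) *
        ∏ j, ∏ m ∈ Finset.range (a j), (β j - (m : ℝ) / (V * NA)) := by
    have h3 : (V * NA) ^ (∑ j, (a j : ℤ)) = ∏ j, (V * NA) ^ (a j) := by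
      rw [Finset.prod_pow_eq_pow_sum, ← zpow_natCast]
      push_cast
      rfl
    rw [h3, ← Finset.prod_mul_distrib]
    refine Finset.prod_congr rfl fun j _ => ?_
    have h4 : (V * NA) ^ (a j) = ∏ m ∈ Finset.range (a j), (V * NA) := by simp
    rw [h4, ← Finset.prod_mul_distrib]
    refine Finset.prod_congr rfl fun m _ => ?_
    rw [mul_sub, mul_div_cancel₀ _ hx]
    ring
  rw [hr, h1, ← mul_assoc, mul_assoc k (_ ^ _), ← zpow_add₀ hx, sub_add_cancel, zpow_one]
  generalize (∏ j, ∏ m ∈ Finset.range (a j), (β j - (m : ℝ) / (V * NA))) = P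
  field_simp
end

section
/- Let N₁, N₂ be positive integers, let k > 0 and N_A > 0 be real constants, let b : Fin N₁ → ℕ and a : Fin N₂ → ℕ, and let α : Fin N₁ → ℝ and β : Fin N₂ → ℝ with α i > 0 and β j > 0 for all i, j. Define r : ℝ → ℝ by r(V) = k · (V·N_A)^(1 − Σ_i b i − Σ_j a j) · ∏_{i} ∏_{m=0}^{b i − 1} (α i · V · N_A − m) · ∏_{j} ∏_{m=0}^{a j − 1} (β j · V · N_A − m). Then V ↦ r(V)/V tends to k · N_A · ∏_{i} (α i)^(b i) · ∏_{j} (β j)^(a j) as V → ∞, and moreover V ↦ r(V) − V · (k · N_A · ∏_i (α i)^(b i) · ∏_j (β j)^(a j)) is bounded as V → ∞. -/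
open Filter Finset Asymptotics

lemma scaled_prod (n : ℕ) (b : Fin n → ℕ) (α : Fin n → ℝ) (t : ℝ) (ht : t ≠ 0) :
    (∏ i, ∏ m ∈ Finset.range (b i), (α i * t - (m : ℝ))) =
      t ^ (∑ i, b i) * ∏ i, ∏ m ∈ Finset.range (b i), (α i - (m : ℝ) * t⁻¹) := by
  rw [← Finset.prod_pow_eq_pow_sum, ← Finset.prod_mul_distrib]
  refine Finset.prod_congr rfl fun i _ => ?_
  have : t ^ b i = ∏ m ∈ Finset.range (b i), t := by simp
  rw [this, ← Finset.prod_mul_distrib]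
  refine Finset.prod_congr rfl fun m _ => ?_
  field_simp

/-- Boundary-reaction case of Lemma 3.2 (reactions `R₊₁` and `R₋M` involving the
chemostatted external species): the mesoscopic rate
`r(V) = k (V N_A)^{1-∑ b i-∑ a j} ∏_i (α_i V N_A)⋯(α_i V N_A - b_i + 1)
  ∏_j (β_j V N_A)⋯(β_j V N_A - a_j + 1)`
satisfies `r(V)/V → k N_A ∏_i α_i^{b_i} ∏_j β_j^{a_j}` as `V → ∞`, and moreover
`r(V) - V · (k N_A ∏_i α_i^{b_i} ∏_j β_j^{a_j}) = O(1)`. -/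
theorem limit_rate_boundary (N₁ N₂ : ℕ) (hN₁ : 0 < N₁) (hN₂ : 0 < N₂)
    (k NA : ℝ) (hk : 0 < k) (hNA : 0 < NA)
    (b : Fin N₁ → ℕ) (a : Fin N₂ → ℕ)
    (α : Fin N₁ → ℝ) (β : Fin N₂ → ℝ)
    (hα : ∀ i, 0 < α i) (hβ : ∀ j, 0 < β j) (r : ℝ → ℝ)
    (hr : ∀ V : ℝ, r V =
      k * (V * NA) ^ ((1 : ℤ) - ∑ i, (b i : ℤ) - ∑ j, (a j : ℤ)) *
        (∏ i, ∏ m ∈ Finset.range (b i), (α i * V * NA - (m : ℝ))) *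
        ∏ j, ∏ m ∈ Finset.range (a j), (β j * V * NA - (m : ℝ))) :
    Tendsto (fun V : ℝ => r V / V) atTop
        (nhds (k * NA * (∏ i, (α i) ^ (b i)) * ∏ j, (β j) ^ (a j))) ∧
      (fun V : ℝ => r V - V * (k * NA * (∏ i, (α i) ^ (b i)) * ∏ j, (β j) ^ (a j)))
        =O[atTop] (fun _ : ℝ => (1 : ℝ)) := by
  obtain ⟨G, hG⟩ : ∃ G : ℝ → ℝ, G = fun x => k * NA *
      (∏ i, ∏ m ∈ Finset.range (b i), (α i - (m : ℝ) * x)) *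
        ∏ j, ∏ m ∈ Finset.range (a j), (β j - (m : ℝ) * x) := ⟨_, rfl⟩
  have hG0 : k * NA * (∏ i, (α i) ^ (b i)) * ∏ j, (β j) ^ (a j) = G 0 := by
    simp [hG]
  have hd : DifferentiableAt ℝ G 0 := by
    rw [hG]
    fun_prop
  have hrG : ∀ V : ℝ, 0 < V → r V = V * G ((V * NA)⁻¹) := by
    intro V hV
    have ht : V * NA ≠ 0 := by positivity
    have e1 := scaled_prod N₁ b α (V * NA) ht
    have e2 := scaled_prod N₂ a β (V * NA) ht
    simp only [← mul_assoc] at e1 e2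
    rw [hr, e1, e2, hG, zpow_sub₀ ht, zpow_sub₀ ht, ← Nat.cast_sum, ← Nat.cast_sum,
      zpow_natCast, zpow_natCast, zpow_one]
    have h1 := pow_ne_zero (∑ i, b i) ht
    have h2 := pow_ne_zero (∑ i, a i) ht
    generalize (V * NA) ^ (∑ i, b i) = p at *
    generalize (V * NA) ^ (∑ i, a i) = q at *
    dsimp only
    generalize (∏ i, ∏ m ∈ Finset.range (b i), (α i - (m : ℝ) * (V * NA)⁻¹)) = A
    generalize (∏ i, ∏ m ∈ Finset.range (a i), (β i - (m : ℝ) * (V * NA)⁻¹)) = B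
    field_simp
  have hx : Tendsto (fun V : ℝ => (V * NA)⁻¹) atTop (nhds 0) :=
    tendsto_inv_atTop_zero.comp (tendsto_id.atTop_mul_const hNA)
  rw [hG0]
  constructor
  · refine (hd.continuousAt.tendsto.comp hx).congr' ?_
    filter_upwards [eventually_gt_atTop 0] with V hV
    rw [hrG V hV]
    simp only [Function.comp]
    field_simp
  · have h := hd.isBigO_sub.comp_tendsto hx
    have h2 := (isBigO_refl (fun V : ℝ => V) atTop).mul h
    refine (h2.congr' ?_ ?_).trans (isBigO_const_const (NA⁻¹) one_ne_zero atTop)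
    · filter_upwards [eventually_gt_atTop 0] with V hV
      rw [hrG V hV]
      simp only [Function.comp]
      ring
    · filter_upwards [eventually_gt_atTop 0] with V hV
      simp only [Function.comp]
      field_simp
      try simp
end

section
/- Let S be a finite type with N ≥ 2 elements, let A : ℝ → Matrix S S ℝ and Â : Matrix S S ℝ be such that for every pair (i, j), the function V ↦ A V i j − V · Â i j is bounded (big-O of 1) as V → ∞. Let H be a subset of S with |H| = s ≥ 1, and suppose Σ_{j ∈ S} det(Â restricted to S \ {j}) ≠ 0. Then the function V ↦ V^(s−1) · det((A V) restricted to Hᶜ) / ( Σ_{j ∈ S} det((A V) restricted to S \ {j}) ) tends, as V → ∞, to det(Â restricted to Hᶜ) / ( Σ_{j ∈ S} det(Â restricted to S \ {j}) ). -/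
open Filter Finset

/-- The determinant of the submatrix of `A` with rows and columns indexed by the
subset `H` of `S`. -/
noncomputable def principalMinor {S : Type*} [Fintype S] [DecidableEq S]
    (A : Matrix S S ℝ) (H : Finset S) : ℝ :=
  (A.submatrix (fun x : H => (x : S)) (fun x : H => (x : S))).det

theorem pm_smul {S : Type*} [Fintype S] [DecidableEq S] (c : ℝ)
    (A : Matrix S S ℝ) (K : Finset S) :
    principalMinor (c • A) K = c ^ K.card * principalMinor A K := by
  unfold principalMinor
  rw [Matrix.submatrix_smul]
  simp [Matrix.det_smul]

theorem pm_continuous {S : Type*} [Fintype S] [DecidableEq S] (K : Finset S) :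
    Continuous (fun A : Matrix S S ℝ => principalMinor A K) := by
  unfold principalMinor
  exact (continuous_id.matrix_submatrix _ _).matrix_det

/-- The key ratio-of-determinants limit in the proof of Theorem 3.5: if
`A(V) = V·Ahat + O(1)` entrywise, `H ⊆ S` has `|H| = s ≥ 1` and the sum of the
principal minors `det(Ahat(S \ {j}))` does not vanish, then
`V^{s-1} · det(A(V)(Hᶜ)) / ∑_{j∈S} det(A(V)({j}ᶜ))` tends to
`det(Ahat(Hᶜ)) / ∑_{j∈S} det(Ahat({j}ᶜ))` as `V → ∞`. -/
theorem limit_minor_ratio {S : Type*} [Fintype S] [DecidableEq S]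
    (hN : 2 ≤ Fintype.card S)
    (A : ℝ → Matrix S S ℝ) (Ahat : Matrix S S ℝ)
    (hA : ∀ i j : S, (fun V : ℝ => A V i j - V * Ahat i j)
      =O[atTop] (fun _ : ℝ => (1 : ℝ)))
    (H : Finset S) (s : ℕ) (hs : H.card = s) (hs1 : 1 ≤ s)
    (hden : ∑ j : S, principalMinor Ahat (Finset.univ.erase j) ≠ 0) :
    Tendsto (fun V : ℝ =>
        (V : ℝ) ^ (s - 1) * principalMinor (A V) Hᶜ /
          ∑ j : S, principalMinor (A V) (Finset.univ.erase j))
      atTop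
      (nhds (principalMinor Ahat Hᶜ /
        ∑ j : S, principalMinor Ahat (Finset.univ.erase j))) := by
  have hB : Tendsto (fun V : ℝ => V⁻¹ • A V) atTop (nhds Ahat) := by
    refine tendsto_pi_nhds.2 fun i => tendsto_pi_nhds.2 fun j => ?_
    have h1 : Tendsto (fun V : ℝ => V⁻¹ * (A V i j - V * Ahat i j)) atTop (nhds 0) := by
      have h2 : (fun V : ℝ => V⁻¹ * (A V i j - V * Ahat i j)) =O[atTop]
          (fun V : ℝ => V⁻¹ * (1 : ℝ)) := (Asymptotics.isBigO_refl _ _).mul (hA i j)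
      refine h2.trans_tendsto ?_
      simpa using tendsto_inv_atTop_zero (𝕜 := ℝ)
    have h3 := h1.add_const (Ahat i j)
    rw [zero_add] at h3
    refine h3.congr' ?_
    filter_upwards [eventually_gt_atTop 0] with V hV
    simp only [Matrix.smul_apply, smul_eq_mul]
    field_simp
    ring
  have hK : ∀ K : Finset S, Tendsto (fun V : ℝ => principalMinor (V⁻¹ • A V) K) atTop
      (nhds (principalMinor Ahat K)) := fun K => ((pm_continuous K).tendsto Ahat).comp hB
  have hlim := (hK Hᶜ).div (tendsto_finsetSum univ
    (fun j _ => hK (Finset.univ.erase j))) hden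
  refine hlim.congr' ?_
  filter_upwards [eventually_gt_atTop 0] with V hV
  have hc : Hᶜ.card + (s - 1) = Fintype.card S - 1 := by
    have := H.card_le_univ
    rw [Finset.card_compl, hs]
    omega
  simp only [Pi.div_apply, pm_smul, Finset.card_erase_of_mem (Finset.mem_univ _),
    Finset.card_univ, ← Finset.mul_sum]
  rw [← hc, pow_add, mul_assoc, mul_div_mul_left _ _ (by positivity), inv_pow V (s - 1),
    mul_comm (V ^ (s - 1)), div_mul_eq_div_div_swap, div_inv_eq_mul, div_mul_eq_mul_div]
end

section
/- Let S be a finite type with N ≥ 2 elements, let A : ℝ → Matrix S S ℝ and Â : Matrix S S ℝ be such that for every pair (i, j), the function V ↦ A V i j − V · Â i j is bounded (big-O of 1) as V → ∞, and suppose Σ_{j ∈ S} det(Â restricted to S \ {j}) ≠ 0. Let s ≥ 2 and let y : Fin s → S be injective, with indices understood cyclically (y_{s+1} := y₁). Define the cycle flux ω(V) = (−1)^(s−1) · ( ∏_{h=1}^{s} A V (y h) (y (h+1)) ) · det((A V) restricted to (range y)ᶜ) / ( Σ_{j ∈ S} det((A V) restricted to S \ {j}) ). Then ω(V)/V tends,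 as V → ∞, to (−1)^(s−1) · ( ∏_{h=1}^{s} Â (y h) (y (h+1)) ) · det(Â restricted to (range y)ᶜ) / ( Σ_{j ∈ S} det(Â restricted to S \ {j}) ). In particular the limit lim_{V→∞} ω(V)/V exists. -/
open Filter Finset

theorem principalMinor_smul_aux {S : Type*} [Fintype S] [DecidableEq S]
    (c : ℝ) (B : Matrix S S ℝ) (H : Finset S) :
    principalMinor (c • B) H = c ^ H.card * principalMinor B H := by
  unfold principalMinor
  have h : (c • B).submatrix (fun x : H => (x : S)) (fun x : H => (x : S))
      = c • B.submatrix (fun x : H => (x : S)) (fun x : H => (x : S)) := rfl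
  rw [h, Matrix.det_smul, Fintype.card_coe]

theorem principalMinor_continuous_aux {S : Type*} [Fintype S] [DecidableEq S]
    (H : Finset S) : Continuous (fun B : Matrix S S ℝ => principalMinor B H) := by
  unfold principalMinor
  exact (continuous_id.matrix_submatrix _ _).matrix_det

/-- Single-cycle form of Theorem 3.5: for a directed cycle `[y₁, …, y_s]` of
distinct states (indices cyclic, `y_{s+1} = y₁`), the mesoscopic cycle flux
`ω(V) = (-1)^{s-1} (∏_h A(V)_{y_h y_{h+1}}) · det(A(V)((range y)ᶜ)) / ∑_j det(A(V)({j}ᶜ))`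
divided by `V` tends, as `V → ∞`, to the corresponding macroscopic expression
built from `Ahat`, where `A(V) = V·Ahat + O(1)` entrywise. -/
theorem limit_cycle_flux {S : Type*} [Fintype S] [DecidableEq S]
    (hN : 2 ≤ Fintype.card S)
    (A : ℝ → Matrix S S ℝ) (Ahat : Matrix S S ℝ)
    (hA : ∀ i j : S, (fun V : ℝ => A V i j - V * Ahat i j)
      =O[atTop] (fun _ : ℝ => (1 : ℝ)))
    (hden : ∑ j : S, principalMinor Ahat (Finset.univ.erase j) ≠ 0)
    (s : ℕ) (hs : 2 ≤ s) [NeZero s] (y : Fin s → S) (hy : Function.Injective y)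
    (ω : ℝ → ℝ)
    (hω : ∀ V : ℝ, ω V =
      (-1 : ℝ) ^ (s - 1) * (∏ h : Fin s, A V (y h) (y (h + 1))) *
        principalMinor (A V) (Finset.univ.image y)ᶜ /
          ∑ j : S, principalMinor (A V) (Finset.univ.erase j)) :
    Tendsto (fun V : ℝ => ω V / V) atTop
      (nhds ((-1 : ℝ) ^ (s - 1) * (∏ h : Fin s, Ahat (y h) (y (h + 1))) *
        principalMinor Ahat (Finset.univ.image y)ᶜ /
          ∑ j : S, principalMinor Ahat (Finset.univ.erase j))) := by
  have hB : Tendsto (fun V : ℝ => V⁻¹ • A V) atTop (nhds Ahat) := by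
    refine tendsto_pi_nhds.2 fun i => tendsto_pi_nhds.2 fun j => ?_
    have h0 : (fun V : ℝ => V⁻¹ * (A V i j - V * Ahat i j)) =o[atTop] (fun _ : ℝ => (1 : ℝ)) := by
      have h1 : (fun V : ℝ => V⁻¹) =o[atTop] (fun _ : ℝ => (1 : ℝ)) :=
        (Asymptotics.isLittleO_one_iff ℝ).2 tendsto_inv_atTop_zero
      simpa using h1.mul_isBigO (hA i j)
    have h2 := ((Asymptotics.isLittleO_one_iff ℝ).1 h0).add_const (Ahat i j)
    rw [zero_add] at h2
    refine h2.congr' ?_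
    filter_upwards [eventually_ne_atTop (0 : ℝ)] with V hV
    simp only [Matrix.smul_apply, smul_eq_mul]
    field_simp
    ring
  have hm : ∀ H : Finset S, Tendsto (fun V : ℝ => principalMinor (V⁻¹ • A V) H) atTop
      (nhds (principalMinor Ahat H)) := fun H =>
    ((principalMinor_continuous_aux H).tendsto Ahat).comp hB
  have he : ∀ i j : S, Tendsto (fun V : ℝ => (V⁻¹ • A V) i j) atTop (nhds (Ahat i j)) :=
    fun i j => (tendsto_pi_nhds.1 ((tendsto_pi_nhds.1 hB) i)) j
  have hlim := (((tendsto_finsetProd (Finset.univ : Finset (Fin s))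
    (fun h _ => he (y h) (y (h + 1)))).const_mul ((-1 : ℝ) ^ (s - 1))).mul
      (hm (Finset.univ.image y)ᶜ)).div
    (tendsto_finsetSum (Finset.univ : Finset S)
      (fun j _ => hm (Finset.univ.erase j))) hden
  refine hlim.congr' ?_
  filter_upwards [eventually_ne_atTop (0 : ℝ)] with V hV
  have hc : (Finset.univ.image y)ᶜ.card = Fintype.card S - s := by
    rw [Finset.card_compl, Finset.card_image_of_injective _ hy, Finset.card_fin]
  have hsN : s ≤ Fintype.card S := by
    simpa using Fintype.card_le_of_injective y hy
  have hAV : A V = V • (V⁻¹ • A V) := by rw [smul_smul, mul_inv_cancel₀ hV, one_smul]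
  rw [hω]
  simp only [Pi.div_apply]
  generalize V⁻¹ • A V = B at hAV ⊢
  rw [hAV]
  simp only [principalMinor_smul_aux, hc, Matrix.smul_apply, smul_eq_mul,
    Finset.prod_mul_distrib, Finset.prod_const, Finset.card_univ,
    Finset.card_erase_of_mem (Finset.mem_univ _), ← Finset.mul_sum]
  obtain ⟨k, hk⟩ := Nat.exists_eq_add_of_le hsN
  have e1 : Fintype.card S - s = k := by omega
  have e2 : Fintype.card S - 1 + 1 = s + k := by omega
  rw [e1]
  have e3 : V ^ s * V ^ k = V ^ (Fintype.card S - 1) * V := by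
    rw [← pow_add, ← e2, pow_succ]
  generalize Fintype.card S - 1 = m at e3 ⊢
  generalize ∑ j : S, principalMinor B (Finset.univ.erase j) = D
  generalize (∏ h : Fin s, B (y h) (y (h + 1))) = P
  generalize principalMinor B (Finset.univ.image y)ᶜ = M
  have hVm : V ^ m * V ≠ 0 := mul_ne_zero (pow_ne_zero _ hV) hV
  rw [div_div, show V ^ m * D * V = (V ^ m * V) * D by ring,
    show (-1 : ℝ) ^ (s - 1) * (V ^ Fintype.card (Fin s) * P) * (V ^ k * M)
      = (V ^ m * V) * ((-1 : ℝ) ^ (s - 1) * P * M) by rw [← e3, Fintype.card_fin]; ring,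
    mul_div_mul_left _ _ hVm]
end

section
/- Let S be a finite type with N ≥ 2 elements, let A : ℝ → Matrix S S ℝ and Â : Matrix S S ℝ be such that for every pair (i, j), the function V ↦ A V i j − V · Â i j is bounded (big-O of 1) as V → ∞, and suppose Σ_{j ∈ S} det(Â restricted to S \ {j}) ≠ 0. Let 𝒞 be a finite index set, and for each c ∈ 𝒞 let s(c) ≥ 2 and let y_c : Fin (s c) → S be injective (a directed cycle, indices cyclic), and let ε : 𝒞 → ℝ with ε c ∈ {0, 1} (indicator weights). Define for each c the cycle flux ω_c(V) = (−1)^(s(c)−1) · ( ∏_{h} A V (y_c h) (y_c (h+1)) ) · det((A V) restricted to (range y_c)ᶜ) / ( Σ_{j ∈ S} det((A V) restricted to S \ {j}) ). Then the limit lim_{V→∞} (1/V) · Σ_{c ∈ 𝒞} ε c · ω_c(V) exists and equals Σ_{c ∈ 𝒞} ε c · (−1)^(s(c)−1) · ( ∏_{h} Â (y_c h) (y_c (h+1)) ) · det(Â restricted to (range y_c)ᶜ) / ( Σ_{j ∈ S} det(Â restricted to S \ {j}) ). -/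
open Filter Finset

theorem aux_tendsto_entry (a : ℝ → ℝ) (b : ℝ)
    (h : (fun V : ℝ => a V - V * b) =O[atTop] (fun _ : ℝ => (1 : ℝ))) :
    Tendsto (fun V : ℝ => V⁻¹ * a V) atTop (nhds b) := by
  have h1 : (fun V : ℝ => V⁻¹ * (a V - V * b)) =O[atTop] (fun V : ℝ => V⁻¹ * (1 : ℝ)) :=
    (Asymptotics.isBigO_refl (fun V : ℝ => V⁻¹) atTop).mul h
  have h2 : Tendsto (fun V : ℝ => V⁻¹ * (a V - V * b)) atTop (nhds 0) := by
    apply h1.trans_tendsto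
    simpa using (tendsto_inv_atTop_zero : Tendsto (fun V : ℝ => V⁻¹) atTop (nhds 0))
  have h3 := h2.add_const b
  rw [zero_add] at h3
  refine h3.congr' ?_
  filter_upwards [eventually_ne_atTop (0 : ℝ)] with V hV
  field_simp
  ring

theorem aux_minor_smul {S : Type*} [Fintype S] [DecidableEq S]
    (A : Matrix S S ℝ) (H : Finset S) (r : ℝ) :
    principalMinor (r • A) H = r ^ H.card * principalMinor A H := by
  unfold principalMinor
  rw [Matrix.submatrix_smul]
  simp [Matrix.det_smul]

theorem aux_minor_cont {S : Type*} [Fintype S] [DecidableEq S] (H : Finset S) :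
    Continuous (fun A : Matrix S S ℝ => principalMinor A H) := by
  unfold principalMinor
  fun_prop

/-- Theorem 3.5 (main result): the macroscopic reaction cycle flux exists.
For a finite family of directed cycles `y_c : Fin (s c) → S` (each injective,
indices cyclic) selected by indicator weights `ε c ∈ {0,1}`, with mesoscopic
cycle fluxes
`ω_c(V) = (-1)^{s(c)-1} (∏_h A(V)_{y_c h, y_c (h+1)}) det(A(V)((range y_c)ᶜ)) / ∑_j det(A(V)({j}ᶜ))`,
where `A(V) = V·Ahat + O(1)` entrywise and the macroscopic minor sum does not
vanish, the limit `lim_{V→∞} (1/V) ∑_c ε c ω_c(V)` exists and equals the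
corresponding macroscopic expression built from `Ahat`. -/
theorem limit_reaction_cycle_flux {S : Type*} [Fintype S] [DecidableEq S]
    (hN : 2 ≤ Fintype.card S)
    (A : ℝ → Matrix S S ℝ) (Ahat : Matrix S S ℝ)
    (hA : ∀ i j : S, (fun V : ℝ => A V i j - V * Ahat i j)
      =O[atTop] (fun _ : ℝ => (1 : ℝ)))
    (hden : ∑ j : S, principalMinor Ahat (Finset.univ.erase j) ≠ 0)
    (𝒞 : Type*) [Fintype 𝒞]
    (s : 𝒞 → ℕ) (hs : ∀ c, 2 ≤ s c) [∀ c, NeZero (s c)]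
    (y : (c : 𝒞) → Fin (s c) → S) (hy : ∀ c, Function.Injective (y c))
    (ε : 𝒞 → ℝ) (hε : ∀ c, ε c = 0 ∨ ε c = 1)
    (ω : 𝒞 → ℝ → ℝ)
    (hω : ∀ (c : 𝒞) (V : ℝ), ω c V =
      (-1 : ℝ) ^ (s c - 1) * (∏ h : Fin (s c), A V (y c h) (y c (h + 1))) *
        principalMinor (A V) (Finset.univ.image (y c))ᶜ /
          ∑ j : S, principalMinor (A V) (Finset.univ.erase j)) :
    Tendsto (fun V : ℝ => (1 / V) * ∑ c : 𝒞, ε c * ω c V) atTop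
      (nhds (∑ c : 𝒞, ε c *
        ((-1 : ℝ) ^ (s c - 1) * (∏ h : Fin (s c), Ahat (y c h) (y c (h + 1))) *
          principalMinor Ahat (Finset.univ.image (y c))ᶜ /
            ∑ j : S, principalMinor Ahat (Finset.univ.erase j)))) := by
  have hB : Tendsto (fun V : ℝ => V⁻¹ • A V) atTop (nhds Ahat) := by
    refine tendsto_pi_nhds.2 fun i => tendsto_pi_nhds.2 fun j => ?_
    simpa using aux_tendsto_entry (fun V => A V i j) (Ahat i j) (hA i j)
  have hm : ∀ H : Finset S, Tendsto (fun V : ℝ => principalMinor (V⁻¹ • A V) H) atTop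
      (nhds (principalMinor Ahat H)) := fun H =>
    ((aux_minor_cont H).tendsto Ahat).comp hB
  have hlim : Tendsto (fun V : ℝ => ∑ c : 𝒞, ε c *
        ((-1 : ℝ) ^ (s c - 1) * (∏ h : Fin (s c), (V⁻¹ • A V) (y c h) (y c (h + 1))) *
          principalMinor (V⁻¹ • A V) (Finset.univ.image (y c))ᶜ /
            ∑ j : S, principalMinor (V⁻¹ • A V) (Finset.univ.erase j))) atTop
      (nhds (∑ c : 𝒞, ε c *
        ((-1 : ℝ) ^ (s c - 1) * (∏ h : Fin (s c), Ahat (y c h) (y c (h + 1))) *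
          principalMinor Ahat (Finset.univ.image (y c))ᶜ /
            ∑ j : S, principalMinor Ahat (Finset.univ.erase j)))) := by
    refine tendsto_finsetSum _ fun c _ => Tendsto.const_mul _ (Tendsto.div
      (Tendsto.mul (Tendsto.const_mul _ (tendsto_finsetProd _ fun h _ => ?_)) (hm _))
      (tendsto_finsetSum _ fun j _ => hm _) hden)
    exact tendsto_pi_nhds.1 (tendsto_pi_nhds.1 hB _) _
  refine hlim.congr' ?_
  filter_upwards [eventually_ne_atTop (0 : ℝ)] with V hV
  rw [Finset.mul_sum]
  refine Finset.sum_congr rfl fun c _ => ?_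
  rw [hω]
  have hcard : (Finset.univ.image (y c)).card = s c := by
    rw [Finset.card_image_of_injective _ (hy c)]; simp
  have hle : s c ≤ Fintype.card S := by
    simpa using Fintype.card_le_of_injective _ (hy c)
  have hprod : ∏ h : Fin (s c), (V⁻¹ • A V) (y c h) (y c (h + 1)) =
      V⁻¹ ^ s c * ∏ h : Fin (s c), A V (y c h) (y c (h + 1)) := by
    simp [Finset.prod_mul_distrib]
  have hsum : ∑ j : S, principalMinor (V⁻¹ • A V) (Finset.univ.erase j) =
      V⁻¹ ^ (Fintype.card S - 1) * ∑ j : S, principalMinor (A V) (Finset.univ.erase j) := by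
    rw [Finset.mul_sum]
    refine Finset.sum_congr rfl fun j _ => ?_
    rw [aux_minor_smul, Finset.card_erase_of_mem (Finset.mem_univ j), Finset.card_univ]
  rw [hprod, hsum, aux_minor_smul, Finset.card_compl, hcard]
  have hpow : V⁻¹ ^ s c * V⁻¹ ^ (Fintype.card S - s c) =
      V⁻¹ ^ (Fintype.card S - 1) * V⁻¹ := by
    rw [← pow_add, ← pow_succ]; congr 1; omega
  have hne : V⁻¹ ^ (Fintype.card S - 1) ≠ 0 := pow_ne_zero _ (inv_ne_zero hV)
  generalize (∑ j : S, principalMinor (A V) (Finset.univ.erase j)) = D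
  generalize (∏ h : Fin (s c), A V (y c h) (y c (h + 1))) = P
  generalize principalMinor (A V) (Finset.univ.image (y c))ᶜ = M
  generalize V⁻¹ ^ (Fintype.card S - 1) = p at *
  calc ε c * ((-1) ^ (s c - 1) * (V⁻¹ ^ s c * P) * (V⁻¹ ^ (Fintype.card S - s c) * M) / (p * D))
      = ε c * ((V⁻¹ ^ s c * V⁻¹ ^ (Fintype.card S - s c)) * ((-1) ^ (s c - 1) * P * M)
          / (p * D)) := by ring
    _ = ε c * ((p * (V⁻¹ * ((-1) ^ (s c - 1) * P * M))) / (p * D)) := by rw [hpow, mul_assoc]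
    _ = ε c * ((V⁻¹ * ((-1) ^ (s c - 1) * P * M)) / D) := by rw [mul_div_mul_left _ _ hne]
    _ = 1 / V * (ε c * ((-1) ^ (s c - 1) * P * M / D)) := by rw [one_div]; ring
end
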